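/- Let K be an algebraically closed field of characteristic p > 0, let V be an m-dimensional vector space over K, and let G be a Zariski-closed subgroup of GL(V). If d(G, V) = m, then the only unipotent element of G is the identity and the image of the determinant map restricted to G is finite. -/

import Mathlib

open CategoryTheory MonoidalCategory Limits

noncomputable section

universe u

/-- The `n`-th tensor power of a representation, in the category `Rep k G`. -/
def tpow {k G : Type u} [Field k] [Monoid G] (V : Rep k G) : ℕ → Rep k G
  | 0 => 𝟙_ (Rep k G)
  | n + 1 => tpow V n ⊗ V

/-- `TS V` : the number of trivial direct summands of `V`, counted with multiplicity, i.e.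
the largest `n` such that the trivial representation on `k^n` is a direct summand of `V`. -/
def TS {k G : Type u} [Field k] [Monoid G] (V : Rep k G) : ℕ :=
  sSup {n : ℕ | ∃ W : Rep k G, Nonempty (V ≅ Rep.trivial k G (Fin n → k) ⊞ W)}

/-- `dG V = limsup_{n → ∞} TS(V^{⊗n})^(1/n)`. -/
def dG {k G : Type u} [Field k] [Monoid G] (V : Rep k G) : ℝ :=
  Filter.limsup (fun n : ℕ => (TS (tpow V n) : ℝ) ^ ((n : ℝ)⁻¹)) Filter.atTop

/-- The representation on `k^m` induced by a group homomorphism to `GL_m(k)`. -/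
def matRep {k G : Type u} [Field k] [Monoid G] {m : ℕ}
    (ρ : G →* Matrix.GeneralLinearGroup (Fin m) k) : Representation k G (Fin m → k) :=
  (Matrix.toLinAlgEquiv'.toRingEquiv.toRingHom.toMonoidHom).comp
    ((Units.coeHom (Matrix (Fin m) (Fin m) k)).comp ρ)

/-- A subset of `GL_m(k)` is Zariski closed if it is the intersection of `GL_m(k)` with the
zero locus of a set of polynomials in the matrix entries. -/
def IsZariskiClosedGL {k : Type u} [Field k] {m : ℕ}
    (Z : Set (Matrix.GeneralLinearGroup (Fin m) k)) : Prop :=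
  ∃ S : Set (MvPolynomial (Fin m × Fin m) k),
    Z = {g : Matrix.GeneralLinearGroup (Fin m) k | ∀ f ∈ S,
      MvPolynomial.eval (fun q : Fin m × Fin m => (g.val : Matrix (Fin m) (Fin m) k) q.1 q.2) f = 0}

/-- The Zariski closure of a subset of `GL_m(k)`: the smallest Zariski-closed subset
containing it. -/
def zariskiClosure {k : Type u} [Field k] {m : ℕ}
    (X : Set (Matrix.GeneralLinearGroup (Fin m) k)) :
    Set (Matrix.GeneralLinearGroup (Fin m) k) :=
  ⋂₀ {Z | IsZariskiClosedGL Z ∧ X ⊆ Z}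

/-- An element of `GL_m(k)` is unipotent if `(g - 1) ^ m = 0`. -/
def IsUnipotentGL {k : Type u} [Field k] {m : ℕ} (g : Matrix.GeneralLinearGroup (Fin m) k) :
    Prop :=
  ((g.val : Matrix (Fin m) (Fin m) k) - 1) ^ m = 0

section TrivialSummands

variable {k G : Type u} [Field k]

lemma TS_le_of_forall_retract [Monoid G] {V : Rep k G} {B : ℕ}
    (h : ∀ (n : ℕ) (i : (Fin n → k) →ₗ[k] V) (q : V →ₗ[k] (Fin n → k)),
      (∀ g x, V.ρ g (i x) = i x) → (∀ g v, q (V.ρ g v) = q v) →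
      (∀ x, q (i x) = x) → n ≤ B) : TS V ≤ B := by
  refine csSup_le' ?_
  rintro n ⟨W, ⟨e⟩⟩
  let i : Rep.trivial k G (Fin n → k) ⟶ V := biprod.inl ≫ e.inv
  let q : V ⟶ Rep.trivial k G (Fin n → k) := e.hom ≫ biprod.fst
  have hiq : i ≫ q = 𝟙 _ := by simp [i, q]
  refine h n i.hom.toLinearMap q.hom.toLinearMap (fun g x => ?_) (fun g v => ?_) (fun x => ?_)
  · exact (Rep.hom_comm_apply i g x).symm
  · exact Rep.hom_comm_apply q g v
  · have := Rep.comp_apply i q x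
    rw [hiq, Rep.id_apply] at this
    exact this.symm

lemma dG_lt_of_TS_tpow_le [Monoid G] {V : Rep k G} {C c d : ℝ} (hc : 0 < c) (hcd : c < d)
    (h : ∀ n, (TS (tpow V n) : ℝ) ≤ C * c ^ n) : dG V < d := by
  obtain ⟨b, hcb, hbd⟩ := exists_between hcd
  have hb : 0 < b := hc.trans hcb
  refine lt_of_le_of_lt ?_ hbd
  refine Filter.limsup_le_of_le
    (Filter.IsCoboundedUnder.of_frequently_ge (a := 0)
      (Filter.Frequently.of_forall fun n => by positivity)) ?_
  have hlim : Filter.Tendsto (fun n : ℕ => C * (c / b) ^ n) Filter.atTop (nhds (C * 0)) :=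
    (tendsto_pow_atTop_nhds_zero_of_lt_one (by positivity) ((div_lt_one hb).2 hcb)).const_mul C
  rw [mul_zero] at hlim
  filter_upwards [hlim.eventually (gt_mem_nhds zero_lt_one), Filter.eventually_gt_atTop 0]
    with n hn hn0
  have hle : (TS (tpow V n) : ℝ) ≤ b ^ n := by
    refine (h n).trans ?_
    rw [div_pow, ← mul_div_assoc, div_lt_one (by positivity)] at hn
    exact hn.le
  calc (TS (tpow V n) : ℝ) ^ ((n : ℝ)⁻¹) ≤ (b ^ n) ^ ((n : ℝ)⁻¹) := by gcongr
    _ = b := Real.pow_rpow_inv_natCast hb.le hn0.ne'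

lemma exists_sum_zpow_lt {ι : Type*} [Fintype ι] (a : ι → ℤ) (ha : ∑ i, a i ≠ 0) :
    ∃ t : ℝ, 0 < t ∧ ∑ i, t ^ a i < Fintype.card ι := by
  by_contra! hcon
  have hder : HasDerivAt (fun t : ℝ => ∑ i, t ^ a i) (∑ i, (a i : ℝ) * 1 ^ (a i - 1)) 1 :=
    HasDerivAt.fun_sum fun i _ => hasDerivAt_zpow (a i) 1 (Or.inl one_ne_zero)
  have hmin : IsLocalMin (fun t : ℝ => ∑ i, t ^ a i) 1 := by
    filter_upwards [lt_mem_nhds (zero_lt_one (α := ℝ))] with t ht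
    simpa using hcon t ht
  have := hmin.hasDerivAt_eq_zero hder
  simp only [one_zpow, mul_one] at this
  exact ha (by exact_mod_cast this)

lemma prod_zpow_eq_zpow_sum {ι M : Type*} [CommGroup M] (t : M) (s : Finset ι)
    (a : ι → ℤ) : ∏ i ∈ s, t ^ a i = t ^ ∑ i ∈ s, a i := by
  classical
  induction s using Finset.induction_on with
  | empty => simp
  | insert i s hi ih => rw [Finset.prod_insert hi, Finset.sum_insert hi, zpow_add, ih]

lemma card_sum_eq_zero_le {ι : Type*} [Fintype ι] (a : ι → ℤ) {t : ℝ} (ht : 0 < t) (n : ℕ) :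
    (Nat.card {w : Fin n → ι // ∑ l, a (w l) = 0} : ℝ) ≤ (∑ i, t ^ a i) ^ n := by
  classical
  rw [Fintype.sum_pow, Nat.card_eq_fintype_card, Fintype.card_subtype, Finset.card_eq_sum_ones,
    Nat.cast_sum, Finset.sum_filter]
  refine Finset.sum_le_sum fun w _ => ?_
  split_ifs with hw
  · have := congrArg Units.val
      (prod_zpow_eq_zpow_sum (Units.mk0 t ht.ne') Finset.univ fun l => a (w l))
    rw [hw] at this
    simpa using this.ge
  · positivity

end TrivialSummands

section StableRank

variable {k H W W' : Type*} [Field k] [Group H] [Fintype H] [AddCommGroup W] [Module k W]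
  [AddCommGroup W'] [Module k W']

/-- The relative trace `∑ h, ρ h ∘ φ ∘ ρ h⁻¹` of a linear endomorphism of a representation. -/
def relTrace (ρ : Representation k H W) (φ : Module.End k W) : Module.End k W :=
  ∑ h, ρ h * φ * ρ h⁻¹

/-- The identity is congruent to an endomorphism of rank at most `r` modulo relative traces. -/
def StableRankLE (ρ : Representation k H W) (r : ℕ) : Prop :=
  ∃ φ : Module.End k W, Module.finrank k (LinearMap.range (1 - relTrace ρ φ)) ≤ r

lemma mul_relTrace (ρ : Representation k H W) (φ : Module.End k W) (g : H) :
    ρ g * relTrace ρ φ = relTrace ρ φ * ρ g := by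
  rw [relTrace, Finset.mul_sum, Finset.sum_mul]
  refine Fintype.sum_equiv (Equiv.mulLeft g) _ _ fun h => ?_
  simp only [Equiv.coe_mulLeft, mul_inv_rev, map_mul]
  simp only [mul_assoc]
  rw [← map_mul, inv_mul_cancel, map_one, mul_one]

lemma relTrace_add (ρ : Representation k H W) (φ ψ : Module.End k W) :
    relTrace ρ (φ + ψ) = relTrace ρ φ + relTrace ρ ψ := by
  simp only [relTrace, mul_add, add_mul, Finset.sum_add_distrib]

lemma relTrace_map_left (ρ : Representation k H W) (σ : Representation k H W')
    (φ : Module.End k W) :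
    relTrace (ρ.tprod σ) (TensorProduct.map φ (1 : Module.End k W')) =
      TensorProduct.map (relTrace ρ φ) (1 : Module.End k W') := by
  have h (g : H) : (σ g : Module.End k W') * 1 * σ g⁻¹ = 1 := by
    rw [mul_one, ← map_mul, mul_inv_cancel, map_one]
  simp only [relTrace, Representation.tprod_apply, ← TensorProduct.map_mul, h]
  simp only [← TensorProduct.mapBilinear_apply, map_sum, LinearMap.sum_apply]

lemma relTrace_map_right (ρ : Representation k H W) (σ : Representation k H W')
    {e : Module.End k W} (he : ∀ h, ρ h * e = e * ρ h) (ψ : Module.End k W') :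
    relTrace (ρ.tprod σ) (TensorProduct.map e ψ) = TensorProduct.map e (relTrace σ ψ) := by
  have h (g : H) : ρ g * e * ρ g⁻¹ = e := by
    rw [he, mul_assoc, ← map_mul, mul_inv_cancel, map_one, mul_one]
  simp only [relTrace, Representation.tprod_apply, ← TensorProduct.map_mul, h]
  simp only [← TensorProduct.mapBilinear_apply, map_sum]

lemma StableRankLE.tprod [FiniteDimensional k W] [FiniteDimensional k W']
    {ρ : Representation k H W} {σ : Representation k H W'} {a b : ℕ}
    (hρ : StableRankLE ρ a) (hσ : StableRankLE σ b) : StableRankLE (ρ.tprod σ) (a * b) := by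
  obtain ⟨φ, hφ⟩ := hρ
  obtain ⟨ψ, hψ⟩ := hσ
  refine ⟨TensorProduct.map φ 1 + TensorProduct.map (1 - relTrace ρ φ) ψ, ?_⟩
  have hcomm (h : H) : ρ h * (1 - relTrace ρ φ) = (1 - relTrace ρ φ) * ρ h := by
    rw [mul_sub, sub_mul, mul_relTrace, mul_one, one_mul]
  have key : 1 - relTrace (ρ.tprod σ)
      (TensorProduct.map φ 1 + TensorProduct.map (1 - relTrace ρ φ) ψ) =
      TensorProduct.map (1 - relTrace ρ φ) (1 - relTrace σ ψ) := by
    rw [relTrace_add, relTrace_map_left, relTrace_map_right _ _ hcomm]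
    refine TensorProduct.ext' fun x y => ?_
    simp [TensorProduct.sub_tmul, TensorProduct.tmul_sub]
    abel
  rw [key, TensorProduct.range_map, ← TensorProduct.range_mapIncl]
  exact (LinearMap.finrank_range_le _).trans
    ((Module.finrank_tensorProduct (R := k)).trans_le (Nat.mul_le_mul hφ hψ))

lemma stableRankLE_finrank [FiniteDimensional k W] (ρ : Representation k H W) :
    StableRankLE ρ (Module.finrank k W) :=
  ⟨0, Submodule.finrank_le _⟩

lemma stableRankLE_pred_of_sum_ne_zero [FiniteDimensional k W] {ρ : Representation k H W}
    (x : W) (l : Module.Dual k W) (hl : ∑ h, l (ρ h x) ≠ 0) :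
    StableRankLE ρ (Module.finrank k W - 1) := by
  set c := ∑ h, l (ρ h x)
  set y := ∑ h, ρ h x with hy
  have hly : l y = c := map_sum _ _ _
  have hinv (g : H) : ρ g y = y := by
    rw [hy, map_sum]
    refine Fintype.sum_equiv (Equiv.mulLeft g) _ _ fun h => ?_
    simp
  refine ⟨c⁻¹ • l.smulRight x, ?_⟩
  have hyker : y ∈ LinearMap.ker (1 - relTrace ρ (c⁻¹ • l.smulRight x)) := by
    suffices y - ∑ h, ρ h x = 0 by simpa [relTrace, LinearMap.sum_apply, hinv, hly, hl]
    rw [hy, sub_self]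
  have hker : 0 < Module.finrank k (LinearMap.ker (1 - relTrace ρ (c⁻¹ • l.smulRight x))) := by
    rw [Module.finrank_pos_iff_exists_ne_zero]
    refine ⟨⟨y, hyker⟩, fun h => hl ?_⟩
    rw [← hly, (Submodule.mk_eq_zero _ _).1 h, map_zero]
  have := LinearMap.finrank_range_add_finrank_ker (1 - relTrace ρ (c⁻¹ • l.smulRight x))
  omega

lemma StableRankLE.le_of_retract [FiniteDimensional k W] {ρ : Representation k H W} {r n : ℕ}
    (hρ : StableRankLE ρ r) (hcard : (Fintype.card H : k) = 0)
    (i : (Fin n → k) →ₗ[k] W) (q : W →ₗ[k] (Fin n → k)) (hi : ∀ g x, ρ g (i x) = i x)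
    (hq : ∀ g v, q (ρ g v) = q v) (hqi : ∀ x, q (i x) = x) : n ≤ r := by
  obtain ⟨φ, hφ⟩ := hρ
  have hret (x) : q ((1 - relTrace ρ φ) (i x)) = x := by
    simp [relTrace, LinearMap.sum_apply, hi, hq, hqi, ← Nat.cast_smul_eq_nsmul k, hcard]
  have hinj : Function.Injective ((1 - relTrace ρ φ).rangeRestrict ∘ₗ i) := by
    intro x y hxy
    rw [← hret x, ← hret y]
    exact congrArg q (congrArg Subtype.val hxy)
  simpa using (LinearMap.finrank_le_finrank_of_injective hinj).trans hφ

lemma StableRankLE.of_equiv {ρ : Representation k H W} {σ : Representation k H W'} {r : ℕ}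
    (e : W ≃ₗ[k] W') (he : ∀ h v, e (ρ h v) = σ h (e v)) (hρ : StableRankLE ρ r) :
    StableRankLE σ r := by
  obtain ⟨φ, hφ⟩ := hρ
  refine ⟨e.toLinearMap ∘ₗ φ ∘ₗ e.symm.toLinearMap, ?_⟩
  have he' (h : H) (v : W') : e.symm (σ h v) = ρ h (e.symm v) := by
    rw [LinearEquiv.symm_apply_eq, he, LinearEquiv.apply_symm_apply]
  have key : 1 - relTrace σ (e.toLinearMap ∘ₗ φ ∘ₗ e.symm.toLinearMap) =
      (e.toLinearMap ∘ₗ (1 - relTrace ρ φ)) ∘ₗ e.symm.toLinearMap := by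
    ext v
    simp [relTrace, LinearMap.sum_apply, he, he']
  rw [key, LinearMap.range_comp_of_range_eq_top _ e.symm.range, LinearMap.range_comp]
  exact (LinearEquiv.finrank_map_eq e _).trans_le hφ

end StableRank

section TensorPowers

variable {k G H : Type u} [Field k] [Group G]

instance [Monoid H] (V : Rep k H) [FiniteDimensional k V] (n : ℕ) :
    FiniteDimensional k (tpow V n) := by
  induction n with
  | zero => exact inferInstanceAs (FiniteDimensional k k)
  | succ n ih => exact inferInstanceAs (FiniteDimensional k (TensorProduct k (tpow V n) V))

lemma finrank_tpow [Monoid H] (V : Rep k H) (n : ℕ) :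
    Module.finrank k (tpow V n) = Module.finrank k V ^ n := by
  induction n with
  | zero => exact Module.finrank_self k
  | succ n ih =>
    rw [pow_succ, ← ih]
    exact Module.finrank_tensorProduct (R := k) (S := k) (M := tpow V n) (M' := V)

lemma nonempty_tpow_add_iso [Monoid H] (V : Rep k H) (a b : ℕ) :
    Nonempty (tpow V (a + b) ≅ tpow V a ⊗ tpow V b) := by
  induction b with
  | zero => exact ⟨(ρ_ _).symm⟩
  | succ b ih => exact ih.map fun e => whiskerRightIso e V ≪≫ α_ _ _ _

lemma StableRankLE.tpow_add {H : Type*} [Group H] [Fintype H] {f : H →* G} {V : Rep k G}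
    [FiniteDimensional k V] {a b r s : ℕ} (ha : StableRankLE ((tpow V a).ρ.comp f) r)
    (hb : StableRankLE ((tpow V b).ρ.comp f) s) :
    StableRankLE ((tpow V (a + b)).ρ.comp f) (r * s) := by
  obtain ⟨e⟩ := nonempty_tpow_add_iso V a b
  let e' := Representation.equivOfIso e.symm
  exact StableRankLE.of_equiv e'.toLinearEquiv (fun h v => Rep.hom_comm_apply e.inv (f h) v)
    (ha.tprod hb)

lemma stableRankLE_tpow_mul_add {H : Type*} [Group H] [Fintype H] {f : H →* G} {V : Rep k G}
    [FiniteDimensional k V] {N s : ℕ} (hN : StableRankLE ((tpow V N).ρ.comp f) s) (q r : ℕ) :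
    StableRankLE ((tpow V (N * q + r)).ρ.comp f) (s ^ q * Module.finrank k V ^ r) := by
  have hpow (n : ℕ) : StableRankLE ((tpow V n).ρ.comp f) (Module.finrank k V ^ n) := by
    rw [← finrank_tpow]
    exact stableRankLE_finrank _
  refine StableRankLE.tpow_add ?_ (hpow r)
  induction q with
  | zero => simpa using hpow 0
  | succ q ih => exact pow_succ s q ▸ ih.tpow_add hN

lemma dG_lt_finrank_of_stableRankLE {H : Type*} [Group H] [Fintype H] {f : H →* G}
    {V : Rep k G} [FiniteDimensional k V] (hV : 2 ≤ Module.finrank k V)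
    (hcard : (Fintype.card H : k) = 0) {N : ℕ} (hN0 : N ≠ 0)
    (hN : StableRankLE ((tpow V N).ρ.comp f) (Module.finrank k V ^ N - 1)) :
    dG V < Module.finrank k V := by
  set m := Module.finrank k V
  have hmN : 2 ≤ m ^ N := hV.trans (Nat.le_self_pow hN0 m)
  set s := m ^ N - 1 with hs
  have hs1 : (1 : ℝ) ≤ s := by exact_mod_cast (by omega : 1 ≤ s)
  set c : ℝ := (s : ℝ) ^ ((N : ℝ)⁻¹) with hc
  have hc1 : 1 ≤ c := Real.one_le_rpow hs1 (by positivity)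
  have hcN : c ^ N = s := Real.rpow_inv_natCast_pow (by positivity) hN0
  have hm1 : (1 : ℝ) ≤ m := by exact_mod_cast (by omega : 1 ≤ m)
  have hcm : c < m := by
    refine lt_of_pow_lt_pow_left₀ N (by positivity) ?_
    rw [hcN]
    exact_mod_cast (by omega : s < m ^ N)
  refine dG_lt_of_TS_tpow_le (C := (m : ℝ) ^ N) (zero_lt_one.trans_le hc1) hcm fun n => ?_
  have hTS : TS (tpow V n) ≤ s ^ (n / N) * m ^ (n % N) := by
    refine TS_le_of_forall_retract fun l i q hi hq hqi => ?_
    have h := stableRankLE_tpow_mul_add hN (n / N) (n % N)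
    rw [Nat.div_add_mod] at h
    exact h.le_of_retract hcard i q (fun g x => hi _ x) (fun g v => hq _ v) hqi
  have hmod : (m : ℝ) ^ (n % N) ≤ (m : ℝ) ^ N :=
    pow_le_pow_right₀ hm1 (Nat.mod_lt _ (Nat.pos_of_ne_zero hN0)).le
  calc (TS (tpow V n) : ℝ) ≤ (s : ℝ) ^ (n / N) * (m : ℝ) ^ (n % N) := by exact_mod_cast hTS
    _ = c ^ (N * (n / N)) * (m : ℝ) ^ (n % N) := by rw [← hcN, pow_mul]
    _ ≤ c ^ n * (m : ℝ) ^ N := by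
      gcongr
      exact Nat.mul_div_le n N
    _ = (m : ℝ) ^ N * c ^ n := mul_comm _ _

end TensorPowers

section OrderP

variable {k G : Type u} [Field k] [Group G]

lemma exists_tpow_vector_dual (V : Rep k G) (v : V) (l : Module.Dual k V) (n : ℕ) :
    ∃ (x : tpow V n) (l' : Module.Dual k (tpow V n)),
      ∀ g, l' ((tpow V n).ρ g x) = l (V.ρ g v) ^ n := by
  induction n with
  | zero => exact ⟨(1 : k), (LinearMap.id : k →ₗ[k] k), fun g => (pow_zero _).symm⟩
  | succ n ih =>
    obtain ⟨x, l', h⟩ := ih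
    refine ⟨(x ⊗ₜ[k] v : TensorProduct k (tpow V n) V),
      (LinearMap.mul' k k ∘ₗ TensorProduct.map l' l : TensorProduct k (tpow V n) V →ₗ[k] k),
      fun g => ?_⟩
    rw [pow_succ, ← h]
    rfl

lemma sum_natCast_pow_pred (p : ℕ) [hp : Fact p.Prime] [CharP k p] :
    ∑ i ∈ Finset.range p, (i : k) ^ (p - 1) = -1 := by
  have hp2 := hp.out.two_le
  have hp1 : p = p - 1 + 1 := by omega
  have hpow (i : ℕ) (hi : i ∈ Finset.range (p - 1)) : ((i + 1 : ℕ) : k) ^ (p - 1) = 1 := by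
    have hi0 : ((i + 1 : ℕ) : k) ≠ 0 := by
      rw [Ne, CharP.cast_eq_zero_iff k p]
      exact Nat.not_dvd_of_pos_of_lt i.succ_pos (by have := Finset.mem_range.1 hi; omega)
    have hfrob := map_natCast (frobenius k p) (i + 1)
    rw [frobenius_def, hp1, pow_succ] at hfrob
    exact (mul_eq_right₀ hi0).1 hfrob
  rw [hp1, Finset.sum_range_succ', Nat.add_sub_cancel, Finset.sum_congr rfl hpow]
  have hcast : ((p - 1 : ℕ) : k) + 1 = 0 := by
    rw [← Nat.cast_succ, Nat.succ_eq_add_one, ← hp1, CharP.cast_eq_zero]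
  rw [Nat.cast_zero, zero_pow (by omega), add_zero]
  simpa using eq_neg_of_add_eq_zero_left hcast

lemma exists_jordan_pair {W : Type*} [AddCommGroup W] [Module k W] {A : Module.End k W}
    (hA : IsNilpotent (A - 1)) (hA1 : A ≠ 1) :
    ∃ v w : W, w ≠ 0 ∧ A v = v + w ∧ A w = w := by
  set N := A - 1 with hN
  have hN0 : N ≠ 0 := sub_ne_zero.2 hA1
  have hclass : 2 ≤ nilpotencyClass N := by
    by_contra! h
    have := pow_nilpotencyClass hA
    interval_cases hc : nilpotencyClass N
    · exact hN0 (by rw [← mul_one N, ← pow_zero N, this, mul_zero])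
    · exact hN0 (by rwa [pow_one] at this)
  have hW : Nontrivial (Module.End k W) := ⟨A, 1, hA1⟩
  obtain ⟨c, hc⟩ : ∃ c, nilpotencyClass N = c + 2 := ⟨nilpotencyClass N - 2, by omega⟩
  have hpred := pow_pred_nilpotencyClass hA
  have hpow := pow_nilpotencyClass hA
  rw [hc] at hpred hpow
  obtain ⟨u, hu⟩ := DFunLike.ne_iff.1 hpred
  have hA_apply (x : W) : A x = x + N x := by simp [hN]
  refine ⟨(N ^ c) u, (N ^ (c + 1)) u, hu, ?_, ?_⟩
  · rw [hA_apply, pow_succ']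
    rfl
  · rw [hA_apply, ← Module.End.mul_apply, ← pow_succ', hpow, LinearMap.zero_apply, add_zero]

lemma dG_lt_finrank_of_orderOf_eq (p : ℕ) [hp : Fact p.Prime] [CharP k p] (V : Rep k G)
    [FiniteDimensional k V] (g : G) (hg : orderOf g = p) (hg1 : V.ρ g ≠ 1) :
    dG V < Module.finrank k V := by
  have hnil : IsNilpotent (V.ρ g - 1) := by
    have : Nontrivial (Module.End k V) := ⟨_, _, hg1⟩
    have : CharP (Module.End k V) p := charP_of_injective_algebraMap
      (FaithfulSMul.algebraMap_injective k (Module.End k V)) p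
    refine ⟨p, ?_⟩
    rw [sub_pow_char_of_commute p (Commute.one_right _), ← map_pow, ← hg, pow_orderOf_eq_one,
      map_one, one_pow, sub_self]
  obtain ⟨u, w, hw, hu, hww⟩ := exists_jordan_pair hnil hg1
  obtain ⟨l, hlw⟩ := Module.Projective.exists_dual_eq_one k hw
  obtain ⟨v, hv, hlv⟩ : ∃ v, V.ρ g v = v + w ∧ l v = 0 := by
    refine ⟨u - l u • w, ?_, by simp [hlw]⟩
    rw [map_sub, map_smul, hu, hww]
    abel
  have hpow (i : ℕ) : V.ρ (g ^ i) v = v + (i : k) • w := by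
    induction i with
    | zero => simp
    | succ i ih =>
      rw [pow_succ', map_mul, Module.End.mul_apply, ih, map_add, map_smul, hv, hww]
      push_cast
      module
  have hli : LinearIndependent k ![w, v] := by
    refine (LinearIndependent.pair_iff' hw).2 fun a ha => hw ?_
    have := hv
    rwa [← ha, map_smul, hww, left_eq_add] at this
  have hdim : 2 ≤ Module.finrank k V := by simpa using hli.fintype_card_le_finrank
  have hp2 := hp.out.two_le
  have hfin : IsOfFinOrder g := orderOf_pos_iff.1 (by omega)
  let _ : Fintype (Subgroup.zpowers g) := Fintype.ofEquiv _ (finEquivZPowers hfin)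
  obtain ⟨x, l', hx⟩ := exists_tpow_vector_dual V v l (p - 1)
  refine dG_lt_finrank_of_stableRankLE (f := (Subgroup.zpowers g).subtype) (N := p - 1) hdim
    ?_ (by omega) ?_
  · rw [← Nat.card_eq_fintype_card, Nat.card_zpowers, hg, CharP.cast_eq_zero]
  · rw [← finrank_tpow]
    refine stableRankLE_pred_of_sum_ne_zero x l' ?_
    have hsum : ∑ h : Subgroup.zpowers g, l' ((tpow V (p - 1)).ρ h x) = -1 := by
      rw [← sum_natCast_pow_pred p, Finset.sum_range,
        ← (finCongr hg).sum_comp, ← (finEquivZPowers hfin).sum_comp]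
      refine Finset.sum_congr rfl fun i _ => ?_
      rw [hx, finEquivZPowers_apply, hpow, map_add, map_smul, hlv, hlw]
      simp
    exact hsum.trans_ne (neg_ne_zero.2 one_ne_zero)

end OrderP

section Eigenvalues

variable {k G : Type u} [Field k] [Group G]

lemma exists_eigenbasis_pow [IsAlgClosed k] (p : ℕ) [Fact p.Prime] [CharP k p] {W : Type*}
    [AddCommGroup W] [Module k W] [FiniteDimensional k W] (A : Module.End k W) :
    ∃ (a : ℕ) (b : Module.Basis (Fin (Module.finrank k W)) k W)
      (c : Fin (Module.finrank k W) → k), ∀ i, (A ^ p ^ a) (b i) = c i • b i := by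
  have hp := Fact.out (p := p.Prime)
  set a := Module.finrank k W
  have hA (μ : k) (v : W) (hv : v ∈ A.maxGenEigenspace μ) : (A ^ p ^ a) v = μ ^ p ^ a • v := by
    rw [Module.End.maxGenEigenspace_eq_genEigenspace_finrank, Module.End.mem_genEigenspace_nat,
      LinearMap.mem_ker] at hv
    rcases subsingleton_or_nontrivial W with h | h
    · exact Subsingleton.elim _ _
    · have : CharP (Module.End k W) p := charP_of_injective_algebraMap
        (FaithfulSMul.algebraMap_injective k (Module.End k W)) p
      have hpow : (A - μ • 1) ^ p ^ a = A ^ p ^ a - μ ^ p ^ a • 1 := by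
        rw [sub_pow_char_pow_of_commute p a ((Commute.one_right A).smul_right μ), smul_pow,
          one_pow]
      have hzero : ((A - μ • 1) ^ p ^ a) v = 0 := by
        rw [← Nat.sub_add_cancel (Nat.lt_pow_self hp.one_lt (n := a)).le, pow_add,
          Module.End.mul_apply, hv, map_zero]
      rw [hpow] at hzero
      simpa [sub_eq_zero] using hzero
  let S : Set W := ⋃ μ, (A.maxGenEigenspace μ : Set W)
  have hS : Submodule.span k S = ⊤ := by
    rw [Submodule.span_iUnion]
    simpa using A.iSup_maxGenEigenspace_eq_top
  obtain ⟨T, hTS, hT, hli⟩ := exists_linearIndependent k S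
  let b := Module.Basis.mk hli (by rw [Subtype.range_coe, hT, hS])
  let _ : Fintype T := FiniteDimensional.fintypeBasisIndex b
  let e : T ≃ Fin a := Fintype.equivFinOfCardEq (Module.finrank_eq_card_basis b).symm
  have hb (i : Fin a) : ∃ μ, b.reindex e i ∈ A.maxGenEigenspace μ := by
    rw [Module.Basis.reindex_apply, Module.Basis.mk_apply]
    exact Set.mem_iUnion.1 (hTS (e.symm i).2)
  choose μ hμ using hb
  exact ⟨a, b.reindex e, fun i => μ i ^ p ^ a, fun i => hA _ _ (hμ i)⟩

lemma exists_eigenbasis_tpow {ι : Type*} (V : Rep k G) (b : Module.Basis ι k V) {g : G}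
    {c : ι → k} (hc : ∀ i, V.ρ g (b i) = c i • b i) (n : ℕ) :
    ∃ B : Module.Basis (Fin n → ι) k (tpow V n),
      ∀ w, (tpow V n).ρ g (B w) = (∏ l, c (w l)) • B w := by
  induction n with
  | zero =>
    exact ⟨(Module.Basis.singleton (Fin 0 → ι) k : Module.Basis (Fin 0 → ι) k k), fun w =>
      (by rw [Fin.prod_univ_zero, one_smul]; rfl)⟩
  | succ n ih =>
    obtain ⟨B, hB⟩ := ih
    let B' : Module.Basis _ k (TensorProduct k (tpow V n) V) := (B.tensorProduct b).reindex
      ((Equiv.prodComm _ _).trans (Fin.snocEquiv fun _ => ι))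
    refine ⟨B', fun w => ?_⟩
    have hB' : B' w = B (Fin.init w) ⊗ₜ[k] b (w (Fin.last n)) := by
      simp [B', Module.Basis.reindex_apply]
    have h : TensorProduct.map ((tpow V n).ρ g) (V.ρ g) (B' w) =
        (∏ l, c (w l)) • B' w := by
      rw [hB', TensorProduct.map_tmul, hB, hc, TensorProduct.smul_tmul_smul,
        Fin.prod_univ_castSucc]
      rfl
    exact h

lemma TS_tpow_le_card {ι : Type*} [Finite ι] (V : Rep k G) (b : Module.Basis ι k V) {g : G}
    {c : ι → k} (hc : ∀ i, V.ρ g (b i) = c i • b i) (n : ℕ) :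
    TS (tpow V n) ≤ Nat.card {w : Fin n → ι // ∏ l, c (w l) = 1} := by
  classical
  let _ := Fintype.ofFinite ι
  obtain ⟨B, hB⟩ := exists_eigenbasis_tpow V b hc n
  refine TS_le_of_forall_retract fun r i q hi _ hqi => ?_
  have hrepr (w : Fin n → ι) (x : tpow V n) :
      B.repr ((tpow V n).ρ g x) w = (∏ l, c (w l)) * B.repr x w := by
    suffices B.coord w ∘ₗ (tpow V n).ρ g = (∏ l, c (w l)) • B.coord w from
      LinearMap.congr_fun this x
    refine B.ext fun w' => ?_
    by_cases hw : w' = w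
    · subst hw; simp [hB]
    · simp [hB, hw]
  let f : (Fin r → k) →ₗ[k] ({w : Fin n → ι // ∏ l, c (w l) = 1} → k) :=
    LinearMap.pi fun w => B.coord w ∘ₗ i
  have hf : Function.Injective f := by
    rw [← LinearMap.ker_eq_bot, LinearMap.ker_eq_bot']
    intro x hx
    have hix : i x = 0 := by
      refine B.ext_elem fun w => ?_
      rw [map_zero, Finsupp.zero_apply]
      by_cases hw : ∏ l, c (w l) = 1
      · exact congrFun hx ⟨w, hw⟩
      · have h := hrepr w (i x)
        rw [hi] at h
        by_contra h0
        exact hw ((mul_eq_right₀ h0).1 h.symm)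
    rw [← hqi x, hix, map_zero]
  simpa [Nat.card_eq_fintype_card] using LinearMap.finrank_le_finrank_of_injective hf

lemma exists_int_dual {ι : Type*} [Finite ι] (L : Submodule ℤ (ι → ℤ)) {x : ι → ℤ}
    (hx : ∀ s : ℤ, s ≠ 0 → s • x ∉ L) :
    ∃ f : (ι → ℤ) →ₗ[ℤ] ℤ, f x ≠ 0 ∧ ∀ y ∈ L, f y = 0 := by
  let T := Submodule.torsion ℤ ((ι → ℤ) ⧸ L)
  have hx0 : T.mkQ (L.mkQ x) ≠ 0 := by
    rw [Ne, Submodule.mkQ_apply, Submodule.Quotient.mk_eq_zero, Submodule.mem_torsion_iff]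
    rintro ⟨s, hs⟩
    refine hx s (nonZeroDivisors.ne_zero s.2) ?_
    rwa [← Submodule.Quotient.mk_eq_zero]
  obtain ⟨f, hf⟩ := Module.Projective.exists_dual_ne_zero ℤ hx0
  refine ⟨f ∘ₗ T.mkQ ∘ₗ L.mkQ, hf, fun y hy => ?_⟩
  rw [LinearMap.comp_apply, LinearMap.comp_apply, Submodule.mkQ_apply L,
    (Submodule.Quotient.mk_eq_zero L).2 hy, map_zero, map_zero]

lemma exists_weights_of_prod_pow_ne_one {ι M : Type*} [Fintype ι] [CommGroup M]
    (c : ℕ → ι → M) (hc : ∀ j s, 0 < s → s ≤ j → (∏ i, c j i) ^ s ≠ 1) :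
    ∃ a : ι → ℤ, ∑ i, a i ≠ 0 ∧
      ∀ n, ∃ j, ∀ w : Fin n → ι, ∏ l, c j (w l) = 1 → ∑ l, a (w l) = 0 := by
  classical
  let U := Filter.hyperfilter ℕ
  let L : AddSubgroup (ι → ℤ) :=
    { carrier := {y | ∀ᶠ j in U, ∏ i, c j i ^ y i = 1}
      zero_mem' := by simp
      add_mem' := fun {y z} hy hz => by
        filter_upwards [hy, hz] with j hyj hzj
        simp [zpow_add, Finset.prod_mul_distrib, hyj, hzj]
      neg_mem' := fun {y} hy => by
        filter_upwards [hy] with j hyj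
        simp [zpow_neg, hyj] }
  have hone (s : ℤ) (hs : s ≠ 0) : s • (1 : ι → ℤ) ∉ L := by
    intro hmem
    have hlarge : ∀ᶠ j in (U : Filter ℕ), s.natAbs ≤ j :=
      (Filter.eventually_ge_atTop _).filter_mono Nat.hyperfilter_le_atTop
    obtain ⟨j, hj, hsj⟩ := (Filter.Eventually.and hmem hlarge).exists
    refine hc j s.natAbs (Int.natAbs_pos.2 hs) hsj ?_
    rw [pow_natAbs_eq_one]
    simpa [Finset.prod_zpow] using hj
  obtain ⟨f, hf1, hfL⟩ := exists_int_dual L.toIntSubmodule hone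
  refine ⟨fun i => f (Pi.single i 1), ?_, fun n => ?_⟩
  · rw [← map_sum, Finset.univ_sum_single]
    exact hf1
  · suffices ∀ᶠ j in U, ∀ w : Fin n → ι,
        ∏ l, c j (w l) = 1 → ∑ l, f (Pi.single (w l) 1) = 0 from this.exists
    rw [Filter.eventually_all]
    intro w
    rw [← map_sum]
    by_cases hw : (∑ l, Pi.single (w l) 1 : ι → ℤ) ∈ L
    · exact Filter.Eventually.of_forall fun j _ => hfL _ hw
    · refine (Ultrafilter.eventually_not.2 hw).mono fun j hj hj' => absurd ?_ hj
      simp only [Finset.sum_apply, ← prod_zpow_eq_zpow_sum (c j _)]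
      rw [Finset.prod_comm]
      refine (Finset.prod_congr rfl fun l _ => ?_).trans hj'
      rw [Finset.prod_eq_single (w l)] <;> simp +contextual

lemma dG_lt_finrank_of_det_pow_ne_one [IsAlgClosed k] (p : ℕ) [Fact p.Prime] [CharP k p]
    (V : Rep k G) [FiniteDimensional k V]
    (hdet : ∀ j : ℕ, ∃ g, ∀ s, 0 < s → s ≤ j → LinearMap.det (V.ρ g) ^ s ≠ 1) :
    dG V < Module.finrank k V := by
  choose g hg using hdet
  choose e b c hc using fun j => exists_eigenbasis_pow p (V.ρ (g j))
  have hprod (j : ℕ) : ∏ i, c j i = LinearMap.det (V.ρ (g j)) ^ p ^ e j := by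
    rw [← map_pow, ← LinearMap.det_toMatrix (b j), ← Matrix.det_diagonal]
    congr 1
    ext i i'
    rw [LinearMap.toMatrix_apply, hc, map_smul, Module.Basis.repr_self, Finsupp.smul_single,
      smul_eq_mul, mul_one, Finsupp.single_apply, Matrix.diagonal_apply]
    grind
  have hdet0 (j : ℕ) : LinearMap.det (V.ρ (g j)) ≠ 0 :=
    ((Group.isUnit (g j)).map V.ρ |>.map LinearMap.det).ne_zero
  have hc0 (j : ℕ) (i : Fin (Module.finrank k V)) : c j i ≠ 0 :=
    Finset.prod_ne_zero_iff.1 ((hprod j).trans_ne (pow_ne_zero _ (hdet0 j))) i (Finset.mem_univ i)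
  obtain ⟨a, ha, hcount⟩ := exists_weights_of_prod_pow_ne_one
    (fun j i => Units.mk0 (c j i) (hc0 j i)) fun j s hs hsj h => hg j s hs hsj <| by
      have h' := congrArg Units.val h
      push_cast at h'
      simp only [Units.val_mk0, hprod] at h'
      rwa [← pow_mul, ExpChar.pow_prime_pow_mul_eq_one_iff] at h'
  obtain ⟨t, ht, hlt⟩ := exists_sum_zpow_lt a ha
  rw [Fintype.card_fin] at hlt
  have hpos : 0 < ∑ i, t ^ a i := by
    obtain ⟨i, -, -⟩ := Finset.exists_ne_zero_of_sum_ne_zero ha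
    exact Finset.sum_pos (fun i _ => zpow_pos ht _) ⟨i, Finset.mem_univ i⟩
  refine dG_lt_of_TS_tpow_le (C := 1) hpos hlt fun n => ?_
  rw [one_mul]
  refine le_trans ?_ (card_sum_eq_zero_le a ht n)
  obtain ⟨j, hj⟩ := hcount n
  have hc' (i : Fin (Module.finrank k V)) :
      V.ρ (g j ^ p ^ e j) (b j i) = c j i • b j i := by
    rw [map_pow, hc]
  refine Nat.cast_le.2 ((TS_tpow_le_card V (b j) hc' n).trans ?_)
  refine Nat.card_le_card_of_injective
    (Subtype.map id fun w hw => hj w (Units.ext ?_)) (Subtype.map_injective _ Function.injective_id)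
  push_cast
  simpa using hw

end Eigenvalues

section LinearGroups

lemma exists_forall_pow_ne_one_of_infinite {k : Type*} [Field k] {S : Set k} (hS : S.Infinite)
    (j : ℕ) : ∃ x ∈ S, ∀ s, 0 < s → s ≤ j → x ^ s ≠ 1 := by
  classical
  obtain ⟨x, hx, hx'⟩ := (hS.sdiff
    (Polynomial.nthRoots j.factorial (1 : k)).toFinset.finite_toSet).nonempty
  refine ⟨x, hx, fun s hs hsj h => hx' ?_⟩
  obtain ⟨d, hd⟩ := Nat.dvd_factorial hs hsj
  rw [Finset.mem_coe, Multiset.mem_toFinset, Polynomial.mem_nthRoots j.factorial_pos, hd, pow_mul,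
    h, one_pow]

lemma matRep_apply {k G : Type u} [Field k] [Monoid G] {m : ℕ}
    (ρ : G →* Matrix.GeneralLinearGroup (Fin m) k) (g : G) :
    matRep ρ g = Matrix.toLin' (ρ g).val :=
  rfl

lemma IsUnipotentGL.pow_eq_one {k : Type u} [Field k] (p : ℕ) [hp : Fact p.Prime] [CharP k p]
    {m : ℕ} {g : Matrix.GeneralLinearGroup (Fin m) k} (hg : IsUnipotentGL g) : g ^ p ^ m = 1 := by
  rcases isEmpty_or_nonempty (Fin m) with h | h
  · exact Subsingleton.elim _ _
  · have hzero : (g.val - 1) ^ p ^ m = 0 :=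
      pow_eq_zero_of_le (Nat.lt_pow_self hp.out.one_lt).le hg
    rw [sub_pow_char_pow_of_commute p m (Commute.one_right _), one_pow, sub_eq_zero] at hzero
    exact Units.ext hzero

end LinearGroups

/-- **Proposition.** In characteristic `p > 0`, if `d(G, V) = m` for a Zariski-closed
subgroup `G ≤ GL_m(k)`, then the only unipotent element of `G` is the identity and the
determinant takes finitely many values on `G`. -/
theorem no_unipotent_and_det_finite_of_dG_eq_dim {k : Type u} [Field k] [IsAlgClosed k]
    (p : ℕ) (hp : 0 < p) [CharP k p] {m : ℕ}
    (G : Subgroup (Matrix.GeneralLinearGroup (Fin m) k))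
    (hclosed : IsZariskiClosedGL (G : Set (Matrix.GeneralLinearGroup (Fin m) k)))
    (hd : dG (Rep.of (matRep G.subtype)) = (m : ℝ)) :
    (∀ g ∈ G, IsUnipotentGL g → g = 1) ∧
      ((fun g : Matrix.GeneralLinearGroup (Fin m) k => Matrix.det g.val) ''
        (G : Set (Matrix.GeneralLinearGroup (Fin m) k))).Finite := by
  have : NeZero p := ⟨hp.ne'⟩
  have : Fact p.Prime := ⟨CharP.char_is_prime_of_pos k p |>.out⟩
  have hfin : Module.finrank k (Rep.of (matRep G.subtype)).V = m := Module.finrank_fin_fun k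
  have : FiniteDimensional k (Rep.of (matRep G.subtype)).V :=
    inferInstanceAs (FiniteDimensional k (Fin m → k))
  constructor
  · intro g hgG hg
    by_contra hg1
    let g' : G := ⟨g, hgG⟩
    have hg'1 : g' ≠ 1 := fun h => hg1 (congrArg Subtype.val h)
    obtain ⟨a, -, ha⟩ := (Nat.dvd_prime_pow Fact.out).1
      (orderOf_dvd_of_pow_eq_one (Subtype.ext (hg.pow_eq_one p) : g' ^ p ^ m = 1))
    have hpdvd : p ∣ orderOf g' := by
      rw [ha]
      refine dvd_pow_self p fun h0 => hg'1 ?_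
      rwa [h0, pow_zero, orderOf_eq_one_iff] at ha
    have horder : orderOf (g' ^ (orderOf g' / p)) = p :=
      orderOf_pow_orderOf_div (ha.trans_ne (pow_ne_zero _ hp.ne')) hpdvd
    refine (dG_lt_finrank_of_orderOf_eq p _ _ horder fun h => ?_).ne (hd.trans (by rw [hfin]))
    have hone : g' ^ (orderOf g' / p) = 1 :=
      Subtype.ext (Units.ext (Matrix.toLin'.injective (h.trans Matrix.toLin'_one.symm)))
    rw [hone, orderOf_one] at horder
    exact (Fact.out : p.Prime).one_lt.ne horder
  · by_contra hinf
    refine (dG_lt_finrank_of_det_pow_ne_one p (Rep.of (matRep G.subtype)) fun j => ?_).ne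
      (hd.trans (by rw [hfin]))
    obtain ⟨-, ⟨g, hgG, rfl⟩, hg⟩ := exists_forall_pow_ne_one_of_infinite hinf j
    refine ⟨⟨g, hgG⟩, fun s hs hsj => ?_⟩
    rw [Rep.of_ρ, matRep_apply, LinearMap.det_toLin']
    exact hg s hs hsj
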